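/- Let K be a simplicial complex on the vertex set [m] and let RAAG_K be the corresponding right-angled Artin group with generators g_1, …, g_m. Consider the set S of all nested iterated commutators (g_{k_1}^{n_1}, (g_{k_2}^{n_2}, …, (g_{k_{ℓ-2}}^{n_{ℓ-2}}, (g_j^{n_{ℓ-1}}, g_i^{n_ℓ})) … )) in RAAG_K, where 2 ≤ ℓ ≤ m, all exponents n_1, …, n_ℓ are nonzero integers, k_1 < … < k_{ℓ-2} < j, i < j, k_s ≠ i for all s, and, in the simple graph on the vertex set J = {k_1, …, k_{ℓ-2}, j, i} whose edges are the 2-element subsets of J that are faces of K, the vertex i lies in a connected component not containing j and i is the smallest vertex of its connected component. Then S is a minimal generating set of the commutator subgroup RAAG_K': the subgroup generated by S equals RAAG_K' = ⁅RAAG_K, RAAG_K⁆, and no proper subset of S generates RAAG_K'. -/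

import Mathlib

/-- The commutator `(g, h) = g⁻¹h⁻¹gh` (the convention of the paper). -/
def pcomm {G : Type*} [Group G] (g h : G) : G := g⁻¹ * h⁻¹ * g * h

/-- The relators of the right-angled Artin group of a simplicial complex `K` on `m` vertices:
the commutators `(gᵢ, gⱼ)` for all edges `{i, j}` of `K`. -/
def raagRels (m : ℕ) (K : Finset (Finset (Fin m))) : Set (FreeGroup (Fin m)) :=
  { r | ∃ i j : Fin m, i ≠ j ∧ ({i, j} : Finset (Fin m)) ∈ K ∧
      r = pcomm (FreeGroup.of i) (FreeGroup.of j) }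

/-- The right-angled Artin group `RAAG_K`, presented with generators `g₁, …, g_m` and
commutation relations for the edges of `K`. -/
abbrev RAAG (m : ℕ) (K : Finset (Finset (Fin m))) : Type := PresentedGroup (raagRels m K)

/-- The canonical generators `gᵢ` of `RAAG_K`. -/
def raagGen {m : ℕ} (K : Finset (Finset (Fin m))) (i : Fin m) : RAAG m K :=
  PresentedGroup.of i

/-- The simple graph on the vertex set `J ⊆ [m]` whose edges are the 2-element subsets of `J`
that are faces of `K` (other vertices of `[m]` are isolated). -/
def graphOn (m : ℕ) (K : Finset (Finset (Fin m))) (J : Finset (Fin m)) : SimpleGraph (Fin m) :=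
  SimpleGraph.fromRel (fun a b => a ∈ J ∧ b ∈ J ∧ ({a, b} : Finset (Fin m)) ∈ K)

/-- The set `S` of basic nested iterated commutators
`(g_{k₁}^{n₁}, (g_{k₂}^{n₂}, …, (g_{k_{ℓ-2}}^{n_{ℓ-2}}, (g_j^{n_{ℓ-1}}, g_i^{n_ℓ}))…))`
in `RAAG_K`, where `2 ≤ ℓ ≤ m`, all exponents are nonzero, `k₁ < ⋯ < k_{ℓ-2} < j`, `i < j`,
`kₛ ≠ i` for all `s`, and in the graph on `J = {k₁, …, k_{ℓ-2}, j, i}` whose edges are the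
2-element subsets of `J` that are faces of `K`, the vertex `i` lies in a connected component
not containing `j` and `i` is the smallest vertex of its connected component. -/
def raagCommSet (m : ℕ) (K : Finset (Finset (Fin m))) : Set (RAAG m K) :=
  { x | ∃ (L : List (Fin m × ℤ)) (j i : Fin m) (nj ni : ℤ),
      List.Chain' (· < ·) (L.map Prod.fst) ∧
      (∀ p ∈ L, p.1 < j) ∧
      i < j ∧
      (∀ p ∈ L, p.1 ≠ i) ∧
      (∀ p ∈ L, p.2 ≠ 0) ∧ nj ≠ 0 ∧ ni ≠ 0 ∧
      L.length + 2 ≤ m ∧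
      ¬ (graphOn m K ((L.map Prod.fst).toFinset ∪ {j, i})).Reachable i j ∧
      (∀ i' : Fin m,
        (graphOn m K ((L.map Prod.fst).toFinset ∪ {j, i})).Reachable i i' → i ≤ i') ∧
      x = L.foldr (fun p w => pcomm (raagGen K p.1 ^ p.2) w)
            (pcomm (raagGen K j ^ nj) (raagGen K i ^ ni)) }

open Function

/-- The support of an exponent vector. -/
def expSupport {m : ℕ} (n : Fin m → ℤ) : Finset (Fin m) := Finset.univ.filter (n · ≠ 0)

/-- The support of `n` without `i` and `j`, in increasing order. -/
def innerIndices {m : ℕ} (n : Fin m → ℤ) (j i : Fin m) : List (Fin m) :=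
  (List.finRange m).filter fun k => n k ≠ 0 ∧ k ≠ i ∧ k ≠ j

/-- The nested commutator of the powers `g k ^ n k`, with innermost entries `j` and `i`. -/
def nestedComm {m : ℕ} {G : Type*} [Group G] (g : Fin m → G) (n : Fin m → ℤ) (j i : Fin m) : G :=
  (innerIndices n j i).foldr (fun k w => pcomm (g k ^ n k) w) (pcomm (g j ^ n j) (g i ^ n i))

/-- The conditions on an exponent vector `n` and the innermost indices `j`, `i` under which the
nested commutator belongs to `raagCommSet`. -/
structure IsAdmissible {m : ℕ} (K : Finset (Finset (Fin m))) (n : Fin m → ℤ) (j i : Fin m) :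
    Prop where
  lt : i < j
  left_ne : n i ≠ 0
  right_ne : n j ≠ 0
  top : ∀ k, j < k → n k = 0
  not_reachable : ¬ (graphOn m K (expSupport n)).Reachable i j
  le_of_reachable : ∀ k, (graphOn m K (expSupport n)).Reachable i k → i ≤ k

theorem mem_innerIndices {m : ℕ} {n : Fin m → ℤ} {j i k : Fin m} :
    k ∈ innerIndices n j i ↔ n k ≠ 0 ∧ k ≠ i ∧ k ≠ j := by
  simp [innerIndices]

theorem pairwise_innerIndices {m : ℕ} (n : Fin m → ℤ) (j i : Fin m) :
    (innerIndices n j i).Pairwise (· < ·) :=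
  (List.pairwise_lt_finRange m).filter _

theorem nodup_innerIndices {m : ℕ} (n : Fin m → ℤ) (j i : Fin m) :
    (innerIndices n j i).Nodup :=
  (pairwise_innerIndices n j i).imp ne_of_lt

theorem innerIndices_toFinset_union {m : ℕ} {n : Fin m → ℤ} {j i : Fin m}
    (hi : n i ≠ 0) (hj : n j ≠ 0) :
    (innerIndices n j i).toFinset ∪ {j, i} = expSupport n := by
  ext k
  simp only [Finset.mem_union, List.mem_toFinset, mem_innerIndices, Finset.mem_insert,
    Finset.mem_singleton, expSupport, Finset.mem_filter, Finset.mem_univ, true_and]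
  by_cases h1 : k = i
  · simp [h1, hi]
  by_cases h2 : k = j
  · simp [h2, hj]
  simp [h1, h2]

/-- Reparametrization of the basic nested commutators by exponent vectors. -/
theorem mem_raagCommSet_iff {m : ℕ} {K : Finset (Finset (Fin m))} {x : RAAG m K} :
    x ∈ raagCommSet m K ↔ ∃ n j i, IsAdmissible K n j i ∧ x = nestedComm (raagGen K) n j i := by
  constructor
  · rintro ⟨L, j, i, nj, ni, hL, hLj, hij, hLi, hL0, hnj, hni, -, hreach, hmin, rfl⟩
    have hP : (L.map Prod.fst).Pairwise (· < ·) := List.isChain_iff_pairwise.1 hL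
    have hnd : (L.map Prod.fst).Nodup := hP.imp ne_of_lt
    let n : Fin m → ℤ := fun k =>
      if k = i then ni else if k = j then nj else (L.lookup k).getD 0
    have hn : ∀ p ∈ L, n p.1 = p.2 := by
      intro p hp
      have h1 : L.lookup p.1 = some p.2 := by
        clear * - hp hnd
        induction L with
        | nil => simp at hp
        | cons q L ih =>
          rw [List.map_cons, List.nodup_cons] at hnd
          rcases List.mem_cons.1 hp with rfl | hp
          · simp [List.lookup]
          · have : p.1 ≠ q.1 := fun h => hnd.1 (h ▸ List.mem_map_of_mem hp)
            have hb : (p.1 == q.1) = false := by simpa using this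
            rw [List.lookup, hb]
            exact ih hnd.2 hp
      simp only [n]
      rw [if_neg (hLi p hp), if_neg (hLj p hp).ne, h1, Option.getD_some]
    have hn0 : ∀ k, k ∉ L.map Prod.fst → k ≠ i → k ≠ j → n k = 0 := by
      intro k hk hki hkj
      have h1 : L.lookup k = none := by
        rw [List.lookup_eq_none_iff]
        intro p hp
        simp only [ne_eq, bne_iff_ne]
        rintro rfl
        exact hk (List.mem_map_of_mem hp)
      simp only [n]
      rw [if_neg hki, if_neg hkj, h1, Option.getD_none]
    have hnI : n i = ni := by simp [n]
    have hnJ : n j = nj := by simp [n, hij.ne']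
    have hLn : L.map Prod.fst = innerIndices n j i := by
      refine List.Pairwise.eq_of_mem_iff hP (pairwise_innerIndices n j i) fun k => ?_
      rw [mem_innerIndices]
      constructor
      · intro hk
        obtain ⟨p, hp, rfl⟩ := List.mem_map.1 hk
        exact ⟨by rw [hn p hp]; exact hL0 p hp, hLi p hp, (hLj p hp).ne⟩
      · rintro ⟨h0, h1, h2⟩
        by_contra hk
        exact h0 (hn0 k hk h1 h2)
    have hni' : n i ≠ 0 := hnI ▸ hni
    have hnj' : n j ≠ 0 := hnJ ▸ hnj
    rw [hLn, innerIndices_toFinset_union hni' hnj'] at hreach hmin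
    refine ⟨n, j, i, ⟨hij, hni', hnj', fun k hk => ?_, hreach, hmin⟩, ?_⟩
    · refine hn0 k (fun h => ?_) (hij.trans hk).ne' hk.ne'
      obtain ⟨p, hp, rfl⟩ := List.mem_map.1 h
      exact absurd (hLj p hp) hk.not_gt
    · clear_value n
      rw [nestedComm, ← hLn, hnI, hnJ, List.foldr_map]
      clear * - hn
      induction L with
      | nil => rfl
      | cons p L ih =>
        rw [List.foldr_cons, List.foldr_cons, ih fun q hq => hn q (List.mem_cons_of_mem _ hq),
          hn p List.mem_cons_self]
  · rintro ⟨n, j, i, h, rfl⟩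
    have hfst : ((innerIndices n j i).map fun k => (k, n k)).map Prod.fst = innerIndices n j i := by
      simp [Function.comp_def]
    refine ⟨(innerIndices n j i).map fun k => (k, n k), j, i, n j, n i, ?_, ?_, h.lt, ?_, ?_,
      h.right_ne, h.left_ne, ?_, ?_, ?_, ?_⟩
    · rw [hfst]
      exact List.isChain_iff_pairwise.2 (pairwise_innerIndices n j i)
    · intro p hp
      obtain ⟨k, hk, rfl⟩ := List.mem_map.1 hp
      rw [mem_innerIndices] at hk
      by_contra hlt
      exact hk.1 (h.top k (lt_of_le_of_ne (not_lt.1 hlt) (Ne.symm hk.2.2)))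
    · intro p hp
      obtain ⟨k, hk, rfl⟩ := List.mem_map.1 hp
      exact (mem_innerIndices.1 hk).2.1
    · intro p hp
      obtain ⟨k, hk, rfl⟩ := List.mem_map.1 hp
      exact (mem_innerIndices.1 hk).1
    · have hnd : (i :: j :: innerIndices n j i).Nodup := by
        simp [nodup_innerIndices, mem_innerIndices, h.lt.ne]
      simpa only [List.length_map, List.length_cons, Fintype.card_fin] using hnd.length_le_card
    · rw [hfst, innerIndices_toFinset_union h.left_ne h.right_ne]
      exact h.not_reachable
    · rw [hfst, innerIndices_toFinset_union h.left_ne h.right_ne]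
      exact h.le_of_reachable
    · rw [nestedComm, List.foldr_map]

section Generation

open scoped commutatorElement

variable {m : ℕ} {G : Type*} [Group G]

/-- The ordered product `g₁ ^ v₁ ⋯ g_m ^ v_m`. -/
def ordProd (g : Fin m → G) (v : Fin m → ℤ) : G :=
  ((List.finRange m).map fun k => g k ^ v k).prod

/-- The element `t g_i ^ v_i t'⁻¹`, where `t'` is the ordered product of the powers `g k ^ v k` and
`t` is the same product with the factor at `i` omitted. -/
def shiftElt (g : Fin m → G) (v : Fin m → ℤ) (i : Fin m) : G :=
  ordProd g (update v i 0) * g i ^ v i * (ordProd g v)⁻¹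

theorem ordProd_update_top (g : Fin m → G) {v : Fin m → ℤ} {j : Fin m}
    (hv : ∀ k, j < k → v k = 0) : ordProd g v = ordProd g (update v j 0) * g j ^ v j := by
  obtain ⟨l₁, l₂, hl⟩ := List.append_of_mem (List.mem_finRange j)
  have hP := List.pairwise_lt_finRange m
  rw [hl, List.pairwise_append, List.pairwise_cons] at hP
  have h1 : ∀ k ∈ l₁, k ≠ j := fun k hk => (hP.2.2 k hk j List.mem_cons_self).ne
  have h2 : ∀ k ∈ l₂, j < k := hP.2.1.1
  have e1 : l₁.map (fun k => g k ^ update v j 0 k) = l₁.map fun k => g k ^ v k :=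
    List.map_congr_left fun k hk => by rw [update_of_ne (h1 k hk)]
  have e2 : (l₂.map fun k => g k ^ v k).prod = 1 :=
    List.prod_eq_one fun x hx => by
      obtain ⟨k, hk, rfl⟩ := List.mem_map.1 hx
      rw [hv k (h2 k hk), zpow_zero]
  have e3 : (l₂.map fun k => g k ^ update v j 0 k).prod = 1 :=
    List.prod_eq_one fun x hx => by
      obtain ⟨k, hk, rfl⟩ := List.mem_map.1 hx
      rw [update_of_ne (h2 k hk).ne', hv k (h2 k hk), zpow_zero]
  simp [ordProd, hl, e1, e2, e3]

theorem prod_map_sublist (g : Fin m → G) (v : Fin m → ℤ) {I : List (Fin m)}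
    (hI : I.Sublist (List.finRange m)) :
    (I.map fun k => g k ^ v k).prod = ordProd g fun k => if k ∈ I then v k else 0 := by
  have key : ∀ L : List (Fin m), L.Nodup → ∀ I : List (Fin m), I.Sublist L →
      (I.map fun k => g k ^ v k).prod =
        (L.map fun k => g k ^ (if k ∈ I then v k else 0)).prod := by
    intro L hL I hI
    induction hI with
    | slnil => rfl
    | @cons I L a hs ih =>
      have ha := (List.nodup_cons.1 hL)
      rw [ih ha.2, List.map_cons, List.prod_cons, if_neg fun h => ha.1 (hs.subset h), zpow_zero,
        one_mul]
    | @cons_cons I L a hs ih =>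
      have ha := (List.nodup_cons.1 hL)
      rw [List.map_cons, List.prod_cons, List.map_cons, List.prod_cons, if_pos List.mem_cons_self,
        ih ha.2]
      congr 2
      refine List.map_congr_left fun k hk => ?_
      have : k ≠ a := fun h => ha.1 (h ▸ hk)
      simp [this]
  exact key _ (List.nodup_finRange m) I hI

theorem shiftElt_of_eq_zero (g : Fin m → G) {v : Fin m → ℤ} {i : Fin m} (h : v i = 0) :
    shiftElt g v i = 1 := by
  have : update v i 0 = v := by rw [← h, update_eq_self]
  simp [shiftElt, this, h]

theorem shiftElt_top (g : Fin m → G) {v : Fin m → ℤ} {j : Fin m}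
    (hv : ∀ k, j < k → v k = 0) : shiftElt g v j = 1 := by
  rw [shiftElt, ← ordProd_update_top g hv, mul_inv_cancel]

theorem shiftElt_mul_shiftElt (g : Fin m → G) (v : Fin m → ℤ) {i k : Fin m} (hik : i ≠ k)
    (hc : Commute (g i) (g k)) :
    shiftElt g (update v k 0) i * shiftElt g v k = shiftElt g (update v i 0) k * shiftElt g v i := by
  have h := (hc.zpow_zpow (v i) (v k)).eq
  have h' : update (update v k 0) i 0 = update (update v i 0) k 0 := update_comm hik.symm ..
  simp only [shiftElt, update_of_ne hik, update_of_ne hik.symm, h']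
  simp only [mul_assoc, inv_mul_cancel_left]
  rw [← mul_assoc (g i ^ v i), h, mul_assoc]

theorem shiftElt_eq_conj_mul (g : Fin m → G) {v : Fin m → ℤ} {i j : Fin m} (hij : i < j)
    (hv : ∀ k, j < k → v k = 0) :
    shiftElt g v i =
      ordProd g (update (update v i 0) j 0) * pcomm (g j ^ (-v j)) (g i ^ (-v i)) *
        (ordProd g (update (update v i 0) j 0))⁻¹ * shiftElt g (update v j 0) i := by
  have h1 := ordProd_update_top g hv
  have h2 := ordProd_update_top g (v := update v i 0) (j := j) fun k hk => by
    rw [update_of_ne (hij.trans hk).ne', hv k hk]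
  rw [update_of_ne hij.ne'] at h2
  have h3 : update (update v j 0) i 0 = update (update v i 0) j 0 := update_comm hij.ne' ..
  simp only [shiftElt, h1, h2, h3, pcomm, update_of_ne hij.ne]
  group

theorem foldr_pcomm_mem_iff (g : Fin m → G) (v : Fin m → ℤ) (w : G) (I : List (Fin m)) :
    ∀ H : Subgroup G,
      (∀ I' : List (Fin m), I'.Sublist I → I' ≠ I →
        (I'.map fun k => g k ^ v k).prod * w * (I'.map fun k => g k ^ v k).prod⁻¹ ∈ H) →
      (I.foldr (fun k x => pcomm (g k ^ (-v k)) x) w ∈ H ↔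
        (I.map fun k => g k ^ v k).prod * w * (I.map fun k => g k ^ v k).prod⁻¹ ∈ H) := by
  induction I with
  | nil => simp
  | cons a I ih =>
    intro H hH
    have hne : ∀ {I' : List (Fin m)}, I'.Sublist I → I' ≠ a :: I := fun hs h => by
      simpa [h] using hs.length_le
    set W := I.foldr (fun k x => pcomm (g k ^ (-v k)) x) w with hW
    have hWH : W ∈ H := (ih H fun I' hs _ => hH I' (hs.cons a) (hne hs)).2
      (hH I (List.sublist_cons_self a I) (hne (List.Sublist.refl I)))
    have hcomap := ih (H.comap (MulAut.conj (g a ^ v a)).toMonoidHom) fun I' hs hI' => by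
      have := hH (a :: I') (hs.cons_cons a) (by simpa using hI')
      simpa only [Subgroup.mem_comap, MulEquiv.coe_toMonoidHom, MulAut.conj_apply, List.map_cons,
        List.prod_cons, mul_inv_rev, mul_assoc] using this
    have e1 : (List.foldr (fun k x => pcomm (g k ^ (-v k)) x) w (a :: I)) =
        (g a ^ v a * W * (g a ^ v a)⁻¹)⁻¹ * W := by
      rw [List.foldr_cons, ← hW, pcomm]
      group
    rw [e1, Subgroup.mul_mem_cancel_right _ hWH, inv_mem_iff]
    simpa only [Subgroup.mem_comap, MulEquiv.coe_toMonoidHom, MulAut.conj_apply, List.map_cons,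
      List.prod_cons, mul_inv_rev, mul_assoc] using hcomap

/-- A subgroup containing the admissible nested commutators contains all elements `shiftElt`. -/
theorem shiftElt_mem {K : Finset (Finset (Fin m))} {g : Fin m → G}
    (hg : ∀ i k, i ≠ k → ({i, k} : Finset (Fin m)) ∈ K → Commute (g i) (g k)) {H : Subgroup G}
    (hH : ∀ n j i, IsAdmissible K n j i → nestedComm g n j i ∈ H) (v : Fin m → ℤ) (i : Fin m) :
    shiftElt g v i ∈ H := by
  induction hc : (expSupport v).card using Nat.strong_induction_on generalizing v i with
  | _ c IH =>
  subst hc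
  have ih : ∀ u : Fin m → ℤ, expSupport u ⊂ expSupport v → ∀ i, shiftElt g u i ∈ H :=
    fun u hu i => IH _ (Finset.card_lt_card hu) u i rfl
  have mem_supp : ∀ {u : Fin m → ℤ} {k}, k ∈ expSupport u ↔ u k ≠ 0 := by simp [expSupport]
  have upd : ∀ k, v k ≠ 0 → expSupport (update v k 0) ⊂ expSupport v := by
    intro k hk
    rw [Finset.ssubset_iff_of_subset]
    · exact ⟨k, mem_supp.2 hk, by simp [expSupport]⟩
    · intro l hl
      rw [mem_supp] at hl ⊢
      rcases eq_or_ne l k with rfl | h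
      · exact hk
      · rwa [update_of_ne h] at hl
  have step : ∀ k l, (graphOn m K (expSupport v)).Adj k l →
      (shiftElt g v k ∈ H ↔ shiftElt g v l ∈ H) := by
    intro k l hkl
    rw [graphOn, SimpleGraph.fromRel_adj] at hkl
    obtain ⟨hne, hkl⟩ := hkl
    have hk : v k ≠ 0 := mem_supp.1 (by tauto)
    have hl : v l ≠ 0 := mem_supp.1 (by tauto)
    have hK : ({k, l} : Finset (Fin m)) ∈ K := by
      rcases hkl with h | h
      · exact h.2.2
      · rw [Finset.pair_comm]; exact h.2.2
    have := shiftElt_mul_shiftElt g v hne (hg k l hne hK)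
    rw [← Subgroup.mul_mem_cancel_left H (ih _ (upd k hk) l), ← this,
      Subgroup.mul_mem_cancel_left H (ih _ (upd l hl) k)]
  have reach : ∀ k l, (graphOn m K (expSupport v)).Reachable k l →
      (shiftElt g v k ∈ H ↔ shiftElt g v l ∈ H) := by
    rintro k l ⟨p⟩
    induction p with
    | nil => rfl
    | cons h _ ih => exact (step _ _ h).trans ih
  by_cases hi : v i = 0
  · rw [shiftElt_of_eq_zero g hi]
    exact H.one_mem
  have hne : (expSupport v).Nonempty := ⟨i, mem_supp.2 hi⟩
  set j := (expSupport v).max' hne with hj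
  have hvj : v j ≠ 0 := mem_supp.1 (Finset.max'_mem _ hne)
  have htop : ∀ k, j < k → v k = 0 := by
    intro k hk
    by_contra h
    exact absurd (Finset.le_max' _ k (mem_supp.2 h)) (not_le.2 hk)
  have hjH : shiftElt g v j ∈ H := by
    rw [shiftElt_top g htop]
    exact H.one_mem
  by_cases hij : (graphOn m K (expSupport v)).Reachable i j
  · exact (reach i j hij).2 hjH
  have hreach_supp : ∀ k, (graphOn m K (expSupport v)).Reachable i k → v k ≠ 0 := by
    intro k hk
    by_contra h0
    have hki : k ≠ i := by rintro rfl; exact hi h0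
    obtain ⟨p⟩ := hk.symm
    cases p with
    | nil => exact hki rfl
    | cons h _ =>
      rw [graphOn, SimpleGraph.fromRel_adj] at h
      exact mem_supp.1 (by tauto) h0
  classical
  obtain ⟨a, ha, hamin⟩ := Finset.exists_min_image
    (Finset.univ.filter fun k => (graphOn m K (expSupport v)).Reachable i k) id
    ⟨i, by simp⟩
  simp only [Finset.mem_filter, Finset.mem_univ, true_and, id] at ha hamin
  rw [reach i a ha]
  have hva := hreach_supp a ha
  have haj : ¬ (graphOn m K (expSupport v)).Reachable a j := fun h => hij (ha.trans h)
  have haj_lt : a < j := by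
    refine lt_of_le_of_ne (Finset.le_max' _ _ (mem_supp.2 hva)) ?_
    rintro h
    exact haj (h ▸ SimpleGraph.Reachable.refl _)
  have hsupp_neg : expSupport (-v) = expSupport v := by
    ext k; simp [expSupport]
  have hadm : IsAdmissible K (-v) j a := by
    refine ⟨haj_lt, by simpa, by simpa, fun k hk => by simp [htop k hk], ?_, ?_⟩
    · rwa [hsupp_neg]
    · rw [hsupp_neg]
      exact fun k hk => hamin k (ha.trans hk)
  have hinner : (fun k => if k ∈ innerIndices (-v) j a then v k else 0) =
      update (update v a 0) j 0 := by
    ext k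
    rcases eq_or_ne k j with rfl | hkj
    · simp [mem_innerIndices]
    rcases eq_or_ne k a with rfl | hka
    · simp [mem_innerIndices, haj_lt.ne]
    by_cases hk : v k = 0 <;> simp [mem_innerIndices, hkj, hka, hk]
  have hsub : (innerIndices (-v) j a).Sublist (List.finRange m) := List.filter_sublist
  rw [shiftElt_eq_conj_mul g haj_lt htop, Subgroup.mul_mem_cancel_right _ (ih _ (upd j hvj) a),
    ← hinner, ← prod_map_sublist g v hsub]
  refine (foldr_pcomm_mem_iff g v _ _ H fun I' hs hI' => ?_).1 (hH _ _ _ hadm)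
  set u : Fin m → ℤ := fun k => if k ∈ I' ∨ k = a ∨ k = j then v k else 0 with hu
  have hsub_mem : ∀ k ∈ I', k ≠ a ∧ k ≠ j := fun k hk => (mem_innerIndices.1 (hs.subset hk)).2
  have huI : (fun k => if k ∈ I' then v k else 0) = update (update u a 0) j 0 := by
    ext k
    rcases eq_or_ne k j with rfl | hkj
    · have hk : j ∉ I' := fun h => (hsub_mem j h).2 rfl
      simp [hk]
    rcases eq_or_ne k a with rfl | hka
    · have hk : k ∉ I' := fun h => (hsub_mem k h).1 rfl
      simp [haj_lt.ne, hk]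
    simp [hkj, hka, hu]
  have hule : expSupport u ⊆ expSupport v := by
    intro k hk
    rw [mem_supp] at hk ⊢
    intro h
    simp [hu, h] at hk
  have hus : expSupport u ⊂ expSupport v := by
    rw [Finset.ssubset_iff_of_subset hule]
    have : ∃ k ∈ innerIndices (-v) j a, k ∉ I' := by
      by_contra! hcon
      refine hI' (hs.eq_of_length_le ?_)
      exact ((nodup_innerIndices _ _ _).subperm hcon).length_le
    obtain ⟨k, hk, hkI⟩ := this
    rw [mem_innerIndices] at hk
    refine ⟨k, mem_supp.2 (by simpa using hk.1), ?_⟩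
    rw [mem_supp, not_not]
    simp [hu, hkI, hk.2.1, hk.2.2]
  have hutop : ∀ k, j < k → u k = 0 := fun k hk => by simp [hu, htop k hk]
  have hua : u a = v a := by simp [hu]
  have huj : u j = v j := by simp [hu]
  have hupd : expSupport (update u j 0) ⊂ expSupport v := by
    refine lt_of_le_of_lt (fun k hk => ?_) hus
    rw [mem_supp] at hk ⊢
    rcases eq_or_ne k j with rfl | h
    · simp at hk
    · rwa [update_of_ne h] at hk
  have := ih u hus a
  rw [shiftElt_eq_conj_mul g haj_lt hutop, Subgroup.mul_mem_cancel_right _ (ih _ hupd a), hua,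
    huj, ← huI, ← prod_map_sublist g v (hs.trans hsub)] at this
  exact this

/-- Modulo a subgroup containing all elements `shiftElt`, every element generated by the `g i`
is an ordered product. -/
theorem exists_mul_ordProd {g : Fin m → G} {H : Subgroup G} (hH : ∀ v i, shiftElt g v i ∈ H)
    {x : G} (hx : x ∈ Subgroup.closure (Set.range g)) : ∃ h ∈ H, ∃ v, x = h * ordProd g v := by
  have hmul : ∀ v i (p : ℤ), ∃ h ∈ H, ∃ v', ordProd g v * g i ^ p = h * ordProd g v' := by
    intro v i p
    refine ⟨_, H.mul_mem (H.inv_mem (hH v i)) (hH (update v i (v i + p)) i),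
      update v i (v i + p), ?_⟩
    simp only [shiftElt, update_idem, update_self]
    group
  have hstep : ∀ x, (∃ h ∈ H, ∃ v, x = h * ordProd g v) → ∀ i (p : ℤ),
      ∃ h ∈ H, ∃ v, x * g i ^ p = h * ordProd g v := by
    rintro _ ⟨h, hh, v, rfl⟩ i p
    obtain ⟨h', hh', v', e⟩ := hmul v i p
    exact ⟨h * h', H.mul_mem hh hh', v', by rw [mul_assoc, e, mul_assoc]⟩
  induction hx using Subgroup.closure_induction_right with
  | one => exact ⟨1, H.one_mem, 0, by simp [ordProd]⟩
  | mul_right x _ y hy ih =>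
    obtain ⟨i, rfl⟩ := hy
    simpa using hstep x ih i 1
  | mul_inv_cancel x _ y hy ih =>
    obtain ⟨i, rfl⟩ := hy
    simpa using hstep x ih i (-1)

theorem pcomm_mem_commutator (a b : G) : pcomm a b ∈ commutator G := by
  have : pcomm a b = ⁅a⁻¹, b⁻¹⁆ := by simp [pcomm, commutatorElement_def]
  rw [this, commutator_def]
  exact Subgroup.commutator_mem_commutator (Subgroup.mem_top _) (Subgroup.mem_top _)

theorem nestedComm_mem_commutator (g : Fin m → G) (n : Fin m → ℤ) (j i : Fin m) :
    nestedComm g n j i ∈ commutator G := by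
  rw [nestedComm]
  cases innerIndices n j i <;> exact pcomm_mem_commutator _ _

end Generation

theorem raagGen_commute {m : ℕ} {K : Finset (Finset (Fin m))} {i k : Fin m} (hik : i ≠ k)
    (hK : {i, k} ∈ K) : Commute (raagGen K i) (raagGen K k) := by
  have h : PresentedGroup.mk (raagRels m K) (pcomm (FreeGroup.of i) (FreeGroup.of k)) = 1 :=
    PresentedGroup.one_of_mem ⟨i, k, hik, hK, rfl⟩
  have h' : (raagGen K i)⁻¹ * (raagGen K k)⁻¹ * raagGen K i * raagGen K k = 1 := h
  rw [mul_assoc, mul_eq_one_iff_inv_eq, mul_inv_rev, inv_inv, inv_inv] at h'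
  exact h'.symm

/-- A family of group elements that commute along the edges of `K` induces a homomorphism from
the right-angled Artin group. -/
def raagLift {m : ℕ} {K : Finset (Finset (Fin m))} {G : Type*} [Group G] (g : Fin m → G)
    (hg : ∀ i k, i ≠ k → {i, k} ∈ K → Commute (g i) (g k)) : RAAG m K →* G :=
  PresentedGroup.toGroup (f := g) <| by
    rintro _ ⟨i, k, hik, hK, rfl⟩
    simp only [pcomm, map_mul, map_inv, FreeGroup.lift_apply_of]
    rw [mul_assoc, (hg i k hik hK).eq]
    group

theorem raagLift_raagGen {m : ℕ} {K : Finset (Finset (Fin m))} {G : Type*} [Group G]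
    (g : Fin m → G) (hg : ∀ i k, i ≠ k → {i, k} ∈ K → Commute (g i) (g k)) (i : Fin m) :
    raagLift g hg (raagGen K i) = g i :=
  PresentedGroup.toGroup.of _

theorem map_ordProd {m : ℕ} {G G' : Type*} [Group G] [Group G'] (f : G →* G') (g : Fin m → G)
    (v : Fin m → ℤ) : f (ordProd g v) = ordProd (f ∘ g) v := by
  simp [ordProd, map_list_prod, Function.comp_def]

theorem closure_raagCommSet (m : ℕ) (K : Finset (Finset (Fin m))) :
    Subgroup.closure (raagCommSet m K) = commutator (RAAG m K) := by
  have hle : Subgroup.closure (raagCommSet m K) ≤ commutator (RAAG m K) := by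
    rw [Subgroup.closure_le]
    intro x hx
    obtain ⟨n, j, i, -, rfl⟩ := mem_raagCommSet_iff.1 hx
    exact nestedComm_mem_commutator _ _ _ _
  refine le_antisymm hle fun x hx => ?_
  have hH : ∀ v i, shiftElt (raagGen K) v i ∈ Subgroup.closure (raagCommSet m K) :=
    shiftElt_mem (fun _ _ => raagGen_commute) fun n j i h =>
      Subgroup.subset_closure (mem_raagCommSet_iff.2 ⟨n, j, i, h, rfl⟩)
  have htop : x ∈ Subgroup.closure (Set.range (raagGen K)) := by
    rw [show Set.range (raagGen K) = Set.range PresentedGroup.of from rfl,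
      PresentedGroup.closure_range_of]
    exact Subgroup.mem_top x
  obtain ⟨h, hh, v, rfl⟩ := exists_mul_ordProd hH htop
  have hv : v = 0 := by
    ext k
    let deg : RAAG m K →* Multiplicative ℤ :=
      raagLift (fun i => if i = k then Multiplicative.ofAdd 1 else 1) fun _ _ _ _ => mul_comm _ _
    have hker := Abelianization.commutator_subset_ker deg
    have hdeg : ∀ i, deg (raagGen K i) = if i = k then Multiplicative.ofAdd 1 else 1 :=
      raagLift_raagGen _ _
    have h1 : deg (ordProd (raagGen K) v) = 1 := by
      have h2 := hker hx
      rwa [MonoidHom.mem_ker, map_mul, MonoidHom.mem_ker.1 (hker (hle hh)), one_mul] at h2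
    have h3 : deg (ordProd (raagGen K) v) = Multiplicative.ofAdd (v k) := by
      rw [map_ordProd, ordProd, ← List.ofFn_eq_map, List.prod_ofFn, Finset.prod_eq_single k]
      · simp [hdeg, ← ofAdd_zsmul]
      · intro b _ hb
        simp [hdeg, hb]
      · simp
    exact Multiplicative.ofAdd.injective (h3.symm.trans h1)
  subst hv
  simpa [ordProd] using hh

section Minimality

variable {m : ℕ}

/-- The permutation of `ℤ^m × ℤ` adding the function `u` of the first component to the second. -/
def vertPerm (u : (Fin m → ℤ) → ℤ) : Equiv.Perm ((Fin m → ℤ) × ℤ) where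
  toFun p := (p.1, p.2 + u p.1)
  invFun p := (p.1, p.2 - u p.1)
  left_inv p := by simp
  right_inv p := by simp

/-- The translation of `ℤ^m × ℤ` by `a` in the `k`-th direction. -/
def translPerm (k : Fin m) (a : ℤ) : Equiv.Perm ((Fin m → ℤ) × ℤ) where
  toFun p := (p.1 + Pi.single k a, p.2)
  invFun p := (p.1 - Pi.single k a, p.2)
  left_inv p := by simp
  right_inv p := by simp

@[simp] theorem vertPerm_apply (u : (Fin m → ℤ) → ℤ) (p : (Fin m → ℤ) × ℤ) :
    vertPerm u p = (p.1, p.2 + u p.1) := rfl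

@[simp] theorem vertPerm_symm_apply (u : (Fin m → ℤ) → ℤ) (p : (Fin m → ℤ) × ℤ) :
    (vertPerm u).symm p = (p.1, p.2 - u p.1) := rfl

@[simp] theorem translPerm_apply (k : Fin m) (a : ℤ) (p : (Fin m → ℤ) × ℤ) :
    translPerm k a p = (p.1 + Pi.single k a, p.2) := rfl

theorem translPerm_one_zpow (k : Fin m) (a : ℤ) : translPerm k 1 ^ a = translPerm k a := by
  induction a using Int.induction_on with
  | zero => ext1 p; simp
  | succ a ih =>
    rw [zpow_add_one, ih]
    ext1 p
    simp only [Equiv.Perm.mul_apply, translPerm_apply, add_assoc, ← Pi.single_add,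
      add_comm (1 : ℤ)]
  | pred a ih =>
    rw [zpow_sub_one, ih, mul_inv_eq_iff_eq_mul]
    ext1 p
    simp [add_assoc, ← Pi.single_add]

theorem translPerm_commute (i k : Fin m) (a b : ℤ) :
    Commute (translPerm i a) (translPerm k b) := by
  ext1 p
  exact Prod.ext (add_right_comm _ _ _) rfl

open scoped Classical in
/-- The translation by `1` in the `k`-th direction, conjugated by `vertPerm u` if `k ∈ C`. -/
noncomputable def gridPerm (u : (Fin m → ℤ) → ℤ) (C : Set (Fin m)) (k : Fin m) :
    Equiv.Perm ((Fin m → ℤ) × ℤ) :=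
  if k ∈ C then vertPerm u * translPerm k 1 * (vertPerm u)⁻¹ else translPerm k 1

theorem gridPerm_commute {u : (Fin m → ℤ) → ℤ} {C : Set (Fin m)} {i k : Fin m}
    (hi : i ∈ C → k ∉ C → ∀ v, u (v + Pi.single k 1) = u v)
    (hk : k ∈ C → i ∉ C → ∀ v, u (v + Pi.single i 1) = u v) :
    Commute (gridPerm u C i) (gridPerm u C k) := by
  have key : ∀ l, (∀ v, u (v + Pi.single l 1) = u v) → Commute (vertPerm u) (translPerm l 1) := by
    intro l hl
    ext1 p
    simp [hl]
  have hconj : ∀ a l, (∀ v, u (v + Pi.single l 1) = u v) →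
      Commute (vertPerm u * translPerm a 1 * (vertPerm u)⁻¹) (translPerm l 1) := fun a l hl =>
    ((key l hl).mul_left (translPerm_commute a l 1 1)).mul_left (key l hl).inv_left
  by_cases h1 : i ∈ C <;> by_cases h2 : k ∈ C <;> simp only [gridPerm, h1, h2, if_true, if_false]
  · exact (Commute.conj_iff _).2 (translPerm_commute i k 1 1)
  · exact hconj i k (hi h1 h2)
  · exact (hconj k i (hk h2 h1)).symm
  · exact translPerm_commute i k 1 1

theorem gridPerm_zpow_apply (u : (Fin m → ℤ) → ℤ) (C : Set (Fin m)) (k : Fin m) (a : ℤ)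
    (p : (Fin m → ℤ) × ℤ) :
    (gridPerm u C k ^ a) p =
      (p.1 + Pi.single k a, p.2 + C.indicator 1 k * (u (p.1 + Pi.single k a) - u p.1)) := by
  by_cases h : k ∈ C
  · simp only [gridPerm, h, if_true, conj_zpow, translPerm_one_zpow, Set.indicator_of_mem]
    simp
    ring
  · simp [gridPerm, h, translPerm_one_zpow]

theorem pcomm_gridPerm_vertPerm (u D : (Fin m → ℤ) → ℤ) (C : Set (Fin m)) (k : Fin m) (a : ℤ) :
    pcomm (gridPerm u C k ^ a) (vertPerm D) =
      vertPerm fun v => D v - D (v + Pi.single k a) := by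
  ext1 p
  simp only [pcomm, ← zpow_neg, Equiv.Perm.mul_apply, gridPerm_zpow_apply, vertPerm_apply,
    Equiv.Perm.inv_def, vertPerm_symm_apply, add_assoc, ← Pi.single_add, add_neg_cancel, Pi.single_zero, add_zero]
  ext1
  · rfl
  · ring

theorem pcomm_gridPerm (u : (Fin m → ℤ) → ℤ) (C : Set (Fin m)) (j i : Fin m) (b a : ℤ) :
    pcomm (gridPerm u C j ^ b) (gridPerm u C i ^ a) =
      vertPerm fun v => (C.indicator 1 j - C.indicator 1 i) *
        ((u v - u (v + Pi.single i a)) -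
          (u (v + Pi.single j b) - u (v + Pi.single j b + Pi.single i a))) := by
  ext1 p
  have h1 : p.1 + Pi.single i a + Pi.single j b + Pi.single i (-a) = p.1 + Pi.single j b := by
    rw [add_right_comm, add_right_comm p.1, add_assoc p.1, ← Pi.single_add]
    simp
  have h2 : p.1 + Pi.single j b + Pi.single j (-b) = p.1 := by
    rw [add_assoc, ← Pi.single_add]
    simp
  simp only [pcomm, ← zpow_neg, Equiv.Perm.mul_apply, gridPerm_zpow_apply, vertPerm_apply, h1, h2]
  ext1
  · rfl
  · rw [add_right_comm p.1 (Pi.single j b)]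
    ring

/-- The function `v ↦ ∏ θ k (v k)` on `ℤ^m`. -/
def prodFun (θ : Fin m → ℤ → ℤ) (v : Fin m → ℤ) : ℤ := ∏ k, θ k (v k)

theorem prodFun_sub (θ : Fin m → ℤ → ℤ) (k : Fin m) (a : ℤ) (v : Fin m → ℤ) :
    prodFun θ v - prodFun θ (v + Pi.single k a) =
      prodFun (update θ k fun x => θ k x - θ k (x + a)) v := by
  simp only [prodFun, Fintype.prod_eq_mul_prod_compl k]
  have h1 : ∏ l ∈ {k}ᶜ, θ l ((v + Pi.single k a : Fin m → ℤ) l) = ∏ l ∈ {k}ᶜ, θ l (v l) :=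
    Finset.prod_congr rfl fun l hl => by
      have hlk : l ≠ k := by simpa using hl
      simp [hlk]
  have h2 : ∏ l ∈ {k}ᶜ, update θ k (fun x => θ k x - θ k (x + a)) l (v l) =
      ∏ l ∈ {k}ᶜ, θ l (v l) :=
    Finset.prod_congr rfl fun l hl => by
      have hlk : l ≠ k := by simpa using hl
      simp [hlk]
  rw [h1, h2, update_self, Pi.add_apply, Pi.single_eq_same, sub_mul]

/-- Replace `θ k` by its difference `θ k - θ k (· + n k)` for all `k` satisfying `p`. -/
def diffOn (n : Fin m → ℤ) (θ : Fin m → ℤ → ℤ) (p : Fin m → Prop) [DecidablePred p] :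
    Fin m → ℤ → ℤ :=
  fun k => if p k then fun x => θ k x - θ k (x + n k) else θ k

theorem foldr_pcomm_gridPerm (u : (Fin m → ℤ) → ℤ) (C : Set (Fin m)) (n : Fin m → ℤ) (c : ℤ)
    (θ : Fin m → ℤ → ℤ) {I : List (Fin m)} (hI : I.Nodup) :
    I.foldr (fun k w => pcomm (gridPerm u C k ^ n k) w) (vertPerm fun v => c * prodFun θ v) =
      vertPerm fun v => c * prodFun (diffOn n θ (· ∈ I)) v := by
  induction I with
  | nil =>
    have : diffOn n θ (· ∈ []) = θ := by ext1 k; simp [diffOn]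
    rw [this, List.foldr_nil]
  | cons a I ih =>
    rw [List.nodup_cons] at hI
    rw [List.foldr_cons, ih hI.2, pcomm_gridPerm_vertPerm]
    congr 1
    ext1 v
    rw [← mul_sub, prodFun_sub]
    congr 2
    ext1 k
    rcases eq_or_ne k a with rfl | h
    · simp [diffOn, hI.1]
    · simp [diffOn, h]

theorem nestedComm_gridPerm (C : Set (Fin m)) (n : Fin m → ℤ) (θ : Fin m → ℤ → ℤ) {j i : Fin m}
    (hij : i ≠ j) (hi : n i ≠ 0) (hj : n j ≠ 0) :
    nestedComm (gridPerm (prodFun θ) C) n j i =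
      vertPerm fun v => (C.indicator 1 j - C.indicator 1 i) *
        prodFun (diffOn n θ (n · ≠ 0)) v := by
  simp only [nestedComm, pcomm_gridPerm, prodFun_sub]
  rw [foldr_pcomm_gridPerm _ _ _ _ _ (nodup_innerIndices n j i)]
  congr 1
  ext1 v
  congr 2
  ext1 k
  rcases eq_or_ne k i with rfl | hki
  · simp [diffOn, mem_innerIndices, hij, hi]
  rcases eq_or_ne k j with rfl | hkj
  · simp [diffOn, mem_innerIndices, hki, hj]
  by_cases hk : n k = 0 <;> simp [diffOn, mem_innerIndices, hki, hkj, hk]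

/-- The indicator function of `n k` if `n k ≠ 0`, and the constant function `1` otherwise. -/
def deltaFun (n : Fin m → ℤ) (k : Fin m) (x : ℤ) : ℤ := if n k = 0 ∨ x = n k then 1 else 0

theorem prodFun_diffOn_deltaFun_ne_zero_iff (n n' : Fin m → ℤ) :
    prodFun (diffOn n' (deltaFun n) (n' · ≠ 0)) 0 ≠ 0 ↔ n' = n := by
  rw [prodFun, Finset.prod_ne_zero_iff, funext_iff]
  refine forall_congr' fun k => ?_
  by_cases h' : n' k = 0 <;> by_cases h : n k = 0 <;>
    simp [diffOn, deltaFun, h', h, eq_comm]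

theorem map_pcomm {G G' : Type*} [Group G] [Group G'] (f : G →* G') (a b : G) :
    f (pcomm a b) = pcomm (f a) (f b) := by
  simp [pcomm]

theorem map_nestedComm {G G' : Type*} [Group G] [Group G'] (f : G →* G') (g : Fin m → G)
    (n : Fin m → ℤ) (j i : Fin m) : f (nestedComm g n j i) = nestedComm (f ∘ g) n j i := by
  simp only [nestedComm]
  induction innerIndices n j i with
  | nil => simp [map_pcomm]
  | cons k I ih => simp [map_pcomm, ih]

theorem IsAdmissible.eq_of_reachable {K : Finset (Finset (Fin m))} {n : Fin m → ℤ}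
    {j i j' i' : Fin m} (h : IsAdmissible K n j i) (h' : IsAdmissible K n j' i')
    (hr : (graphOn m K (expSupport n)).Reachable i i') : i = i' :=
  le_antisymm (h.le_of_reachable _ hr) (h'.le_of_reachable _ hr.symm)

theorem IsAdmissible.top_eq {K : Finset (Finset (Fin m))} {n : Fin m → ℤ}
    {j i j' i' : Fin m} (h : IsAdmissible K n j i) (h' : IsAdmissible K n j' i') : j = j' :=
  le_antisymm (not_lt.1 fun hlt => h.right_ne (h'.top _ hlt))
    (not_lt.1 fun hlt => h'.right_ne (h.top _ hlt))

/-- Every basic nested commutator is moved, and every other one is fixed, by some action of the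
right-angled Artin group on a pointed set. -/
theorem exists_hom_separating {K : Finset (Finset (Fin m))} {n : Fin m → ℤ} {j i : Fin m}
    (h : IsAdmissible K n j i) :
    ∃ f : RAAG m K →* Equiv.Perm ((Fin m → ℤ) × ℤ),
      f (nestedComm (raagGen K) n j i) 0 ≠ 0 ∧
      ∀ x ∈ raagCommSet m K, x ≠ nestedComm (raagGen K) n j i → f x 0 = 0 := by
  set C : Set (Fin m) := {k | (graphOn m K (expSupport n)).Reachable i k} with hC
  have hCsupp : ∀ k ∈ C, n k ≠ 0 := by
    intro k hk h0
    obtain ⟨p⟩ := SimpleGraph.Reachable.symm hk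
    cases p with
    | nil => exact h.left_ne h0
    | cons hadj _ =>
      rw [graphOn, SimpleGraph.fromRel_adj] at hadj
      have : k ∈ expSupport n := by tauto
      exact (Finset.mem_filter.1 this).2 h0
  have hinv : ∀ a b, a ≠ b → {a, b} ∈ K → a ∈ C → b ∉ C →
      ∀ v, prodFun (deltaFun n) (v + Pi.single b 1) = prodFun (deltaFun n) v := by
    intro a b hab hK ha hb v
    have hnb : n b = 0 := by
      by_contra hnb
      refine hb (SimpleGraph.Reachable.trans ha (SimpleGraph.Adj.reachable ?_))
      rw [graphOn, SimpleGraph.fromRel_adj]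
      exact ⟨hab, Or.inl ⟨by simp [expSupport, hCsupp a ha], by simp [expSupport, hnb], hK⟩⟩
    refine Finset.prod_congr rfl fun k _ => ?_
    rcases eq_or_ne k b with rfl | hkb
    · simp [deltaFun, hnb]
    · simp [hkb]
  have hcomm : ∀ a b, a ≠ b → {a, b} ∈ K →
      Commute (gridPerm (prodFun (deltaFun n)) C a) (gridPerm (prodFun (deltaFun n)) C b) :=
    fun a b hab hK => gridPerm_commute (hinv a b hab hK)
      (hinv b a hab.symm (by rwa [Finset.pair_comm]))
  have hval : ∀ n' j' i', IsAdmissible K n' j' i' →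
      raagLift _ hcomm (nestedComm (raagGen K) n' j' i') 0 =
        (0, (C.indicator 1 j' - C.indicator 1 i') *
          prodFun (diffOn n' (deltaFun n) (n' · ≠ 0)) 0) := by
    intro n' j' i' h'
    have hcomp : raagLift _ hcomm ∘ raagGen K = gridPerm (prodFun (deltaFun n)) C :=
      funext (raagLift_raagGen _ hcomm)
    rw [map_nestedComm, hcomp, nestedComm_gridPerm C n' _ h'.lt.ne h'.left_ne h'.right_ne]
    simp
  have hiC : i ∈ C := SimpleGraph.Reachable.refl i
  have hjC : j ∉ C := h.not_reachable
  refine ⟨raagLift _ hcomm, ?_, ?_⟩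
  · rw [hval n j i h]
    have := (prodFun_diffOn_deltaFun_ne_zero_iff n n).2 rfl
    simpa [Prod.ext_iff, hiC, hjC] using this
  · intro x hx hne
    obtain ⟨n', j', i', h', rfl⟩ := mem_raagCommSet_iff.1 hx
    rw [hval n' j' i' h', Prod.mk_eq_zero]
    refine ⟨rfl, ?_⟩
    by_cases hn : n' = n
    · subst hn
      obtain rfl := h.top_eq h'
      have hi' : i' ∉ C := fun hr => hne (by rw [h.eq_of_reachable h' hr])
      simp [hi', hjC]
    · rw [not_not.1 (mt (prodFun_diffOn_deltaFun_ne_zero_iff n n').1 hn), mul_zero]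

end Minimality

/-- The set of basic nested iterated commutators is a minimal generating set of the commutator
subgroup `RAAG_K'` of the right-angled Artin group: it generates `RAAG_K'`, and no proper
subset of it generates `RAAG_K'`. -/
theorem raag_commutator_minimal_generating_set (m : ℕ) (K : Finset (Finset (Fin m)))
    (hdown : ∀ I ∈ K, ∀ J ⊆ I, J ∈ K) (hempty : (∅ : Finset (Fin m)) ∈ K)
    (hsingle : ∀ i : Fin m, ({i} : Finset (Fin m)) ∈ K) :
    Subgroup.closure (raagCommSet m K) = commutator (RAAG m K) ∧
      ∀ T ⊂ raagCommSet m K, Subgroup.closure T ≠ commutator (RAAG m K) := by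
  refine ⟨closure_raagCommSet m K, fun T hT hcl => ?_⟩
  obtain ⟨s, hs, hsT⟩ := Set.exists_of_ssubset hT
  obtain ⟨n, j, i, h, rfl⟩ := mem_raagCommSet_iff.1 hs
  obtain ⟨f, hf, hfix⟩ := exists_hom_separating h
  have hle : Subgroup.closure T ≤ (MulAction.stabilizer _ (0 : (Fin m → ℤ) × ℤ)).comap f := by
    rw [Subgroup.closure_le]
    intro x hx
    exact hfix x (hT.subset hx) fun hxs => hsT (hxs ▸ hx)
  exact hf (hle (hcl ▸ nestedComm_mem_commutator (raagGen K) n j i))
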